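/- Let X be a second-countable locally compact Hausdorff space and let κ be a kernel on X satisfying (R1), (R2), (R3). Let A ⊂ X with closure Ā ≠ X and cp_*A > 0, and set Ω := X∖Ā. For any ψ ∈ C_0(X) of the form ψ = U^θ with θ ∈ E, writing θ = θ⁺ − θ⁻ for the Hahn–Jordan decomposition, one has for every x ∈ Ω: ε_x^A(ψ) = U^{(θ⁺)^A}(x) − U^{(θ⁻)^A}(x). In particular, x ↦ ε_x^A(ψ) is a difference of two lower semicontinuous functions on Ω. -/

import Mathlib

open MeasureTheory Filter Set Topology ENNReal CompactlySupported UniformConvergence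

namespace Balayage
open scoped Classical

variable {X : Type*} [TopologicalSpace X] [MeasurableSpace X]

/-- A kernel: symmetric, lower semicontinuous, `[0,∞]`-valued. -/
structure IsKernel (κ : X → X → ℝ≥0∞) : Prop where
  symm : ∀ x y, κ x y = κ y x
  lsc : LowerSemicontinuous fun p : X × X => κ p.1 p.2

/-- The potential `U^μ(x) = ∫ κ(x,y) dμ(y)`. -/
noncomputable def potential (κ : X → X → ℝ≥0∞) (μ : Measure X) (x : X) : ℝ≥0∞ :=
  ∫⁻ y, κ x y ∂μ

/-- The mutual energy `I(μ,ν) = ∫∫ κ(x,y) dν(y) dμ(x)` of two positive measures. -/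
noncomputable def energy (κ : X → X → ℝ≥0∞) (μ ν : Measure X) : ℝ≥0∞ :=
  ∫⁻ x, potential κ ν x ∂μ

/-- A positive Radon measure (regular Borel measure, finite on compacts). -/
def IsRadon (μ : Measure X) : Prop := μ.Regular

/-- Finite energy: `I(μ) < ∞`. -/
def FiniteEnergy (κ : X → X → ℝ≥0∞) (μ : Measure X) : Prop := energy κ μ μ < ⊤

/-- Membership in the cone `E⁺` of positive Radon measures of finite energy. -/
def memE (κ : X → X → ℝ≥0∞) (μ : Measure X) : Prop := IsRadon μ ∧ FiniteEnergy κ μ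

/-- Membership in `E⁺(A)`: measures of `E⁺` concentrated on `A`
(i.e. the complement of `A` is negligible). -/
def memEOn (κ : X → X → ℝ≥0∞) (A : Set X) (μ : Measure X) : Prop :=
  memE κ μ ∧ μ Aᶜ = 0

/-- The strong (energy) distance `‖μ-ν‖ = √(I(μ)+I(ν)-2I(μ,ν))`. -/
noncomputable def sDist (κ : X → X → ℝ≥0∞) (μ ν : Measure X) : ℝ :=
  Real.sqrt ((energy κ μ μ).toReal + (energy κ ν ν).toReal - 2 * (energy κ μ ν).toReal)

/-- Membership in `E'(A)`, the strong closure of `E⁺(A)` in `E⁺`. -/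
def memEClos (κ : X → X → ℝ≥0∞) (A : Set X) (μ : Measure X) : Prop :=
  memE κ μ ∧ ∀ ε : ℝ, 0 < ε → ∃ ν, memEOn κ A ν ∧ sDist κ μ ν < ε

/-- The capacity of a compact set: the inverse of the minimal energy of
probability measures concentrated on it. -/
noncomputable def capC (κ : X → X → ℝ≥0∞) (K : Set X) : ℝ≥0∞ :=
  (⨅ (μ : Measure X) (_ : IsProbabilityMeasure μ) (_ : μ Kᶜ = 0), energy κ μ μ)⁻¹

/-- The inner capacity `cp_* A`: supremum of capacities of compact subsets. -/
noncomputable def innerCap (κ : X → X → ℝ≥0∞) (A : Set X) : ℝ≥0∞ :=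
  ⨆ (K : Set X) (_ : IsCompact K) (_ : K ⊆ A), capC κ K

/-- The outer capacity `cp^* A`: infimum of inner capacities of open supersets. -/
noncomputable def outerCap (κ : X → X → ℝ≥0∞) (A : Set X) : ℝ≥0∞ :=
  ⨅ (D : Set X) (_ : IsOpen D) (_ : A ⊆ D), innerCap κ D

/-- Strict positive definiteness (energy principle), stated for pairs of positive
measures of finite energy: `I(μ-ν) ≥ 0`, with equality only for `μ = ν`. -/
def StrictlyPosDef (κ : X → X → ℝ≥0∞) : Prop :=
  ∀ μ ν : Measure X, IsRadon μ → IsRadon ν → FiniteEnergy κ μ → FiniteEnergy κ ν →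
    (2 * energy κ μ ν ≤ energy κ μ μ + energy κ ν ν) ∧
    (2 * energy κ μ ν = energy κ μ μ + energy κ ν ν → μ = ν)

/-- Vague convergence of a sequence of measures: convergence of integrals of
continuous compactly supported functions. -/
def VagueTendsto (μ : ℕ → Measure X) (μ₀ : Measure X) : Prop :=
  ∀ f : X → ℝ, Continuous f → HasCompactSupport f →
    Tendsto (fun j => ∫ x, f x ∂(μ j)) atTop (nhds (∫ x, f x ∂μ₀))

/-- A perfect kernel: strictly positive definite, `E⁺` strongly complete, and the strong
topology on `E⁺` finer than the vague topology (sequential formulation; sequences suffice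
on second-countable spaces). -/
structure Perfect (κ : X → X → ℝ≥0∞) : Prop where
  posdef : StrictlyPosDef κ
  complete : ∀ μ : ℕ → Measure X, (∀ j, memE κ (μ j)) →
    (∀ ε : ℝ, 0 < ε → ∃ N, ∀ m ≥ N, ∀ n ≥ N, sDist κ (μ m) (μ n) < ε) →
    ∃ μ₀, memE κ μ₀ ∧ Tendsto (fun j => sDist κ (μ j) μ₀) atTop (nhds 0)
  finerThanVague : ∀ (μ : ℕ → Measure X) (μ₀ : Measure X), (∀ j, memE κ (μ j)) →
    memE κ μ₀ → Tendsto (fun j => sDist κ (μ j) μ₀) atTop (nhds 0) → VagueTendsto μ μ₀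

/-- The domination principle. -/
def Domination (κ : X → X → ℝ≥0∞) : Prop :=
  ∀ μ ν : Measure X, memE κ μ → IsRadon ν →
    (∀ᵐ x ∂μ, potential κ μ x ≤ potential κ ν x) → ∀ x, potential κ μ x ≤ potential κ ν x

/-- `h`-Ugaheri's maximum principle; for `h = 1` this is Frostman's maximum principle. -/
def Ugaheri (κ : X → X → ℝ≥0∞) (h : ℝ) : Prop :=
  ∀ μ : Measure X, memE κ μ → ∀ c : ℝ, 0 < c →
    (∀ᵐ x ∂μ, potential κ μ x ≤ ENNReal.ofReal c) →
    ∀ x, potential κ μ x ≤ ENNReal.ofReal (h * c)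

/-- Condition (R1): the kernel is perfect and satisfies the domination and
`h`-Ugaheri maximum principles for some `h ∈ [1, ∞)`. -/
structure R1 (κ : X → X → ℝ≥0∞) : Prop where
  perfect : Perfect κ
  domination : Domination κ
  ugaheri : ∃ h : ℝ, 1 ≤ h ∧ Ugaheri κ h

/-- Condition (R2): `κ(x,y)` is continuous and finite off the diagonal. -/
def R2 (κ : X → X → ℝ≥0∞) : Prop :=
  ContinuousOn (fun p : X × X => κ p.1 p.2) {p : X × X | p.1 ≠ p.2} ∧
    ∀ x y : X, x ≠ y → κ x y ≠ ⊤

/-- Condition (R3): `κ(·,y) → 0` uniformly on compact sets as `y` tends to the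
Alexandroff point of `X`. -/
def R3 (κ : X → X → ℝ≥0∞) : Prop :=
  ∀ K : Set X, IsCompact K → ∀ ε : ℝ≥0∞, 0 < ε →
    ∃ K' : Set X, IsCompact K' ∧ ∀ y ∉ K', ∀ x ∈ K, κ x y < ε

/-- `μA` is the inner balayage of `ω` onto `A`: it belongs to `E'(A)` and its potential
coincides with that of `ω` nearly everywhere on `A` (up to a set of inner capacity zero). -/
def IsInnerBalayage (κ : X → X → ℝ≥0∞) (A : Set X) (ω μA : Measure X) : Prop :=
  memEClos κ A μA ∧ innerCap κ {x ∈ A | potential κ μA x ≠ potential κ ω x} = 0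

/-- `μA` is the outer balayage of `ω` onto `A`: it belongs to `E'(A)` and its potential
coincides with that of `ω` quasi-everywhere on `A` (up to a set of outer capacity zero). -/
def IsOuterBalayage (κ : X → X → ℝ≥0∞) (A : Set X) (ω μA : Measure X) : Prop :=
  memEClos κ A μA ∧ outerCap κ {x ∈ A | potential κ μA x ≠ potential κ ω x} = 0

/-- Membership in the class `Γ_{A,ω}` of positive finite-energy Radon measures whose
potential dominates that of `ω` nearly everywhere on `A`. -/
def memGamma (κ : X → X → ℝ≥0∞) (A : Set X) (ω ν : Measure X) : Prop :=
  memE κ ν ∧ innerCap κ {x ∈ A | ¬ potential κ ω x ≤ potential κ ν x} = 0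


section Helpers

set_option linter.unusedSectionVars false
set_option linter.style.haveILetI false

variable {X : Type*} [TopologicalSpace X] [T2Space X] [LocallyCompactSpace X]
    [SecondCountableTopology X] [MeasurableSpace X] [BorelSpace X] {κ : X → X → ℝ≥0∞}

theorem isRadon_of_finiteOnCompacts (μ : Measure X) [IsFiniteMeasureOnCompacts μ] : IsRadon μ := by
  letI : TopologicalSpace.MetrizableSpace X := TopologicalSpace.metrizableSpace_of_t3_secondCountable X
  unfold IsRadon
  infer_instance

theorem IsKernel.measurable (hκ : IsKernel κ) : Measurable fun p : X × X => κ p.1 p.2 :=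
  hκ.lsc.measurable

theorem measurable_potential (hκ : IsKernel κ) (μ : Measure X) [SFinite μ] :
    Measurable (potential κ μ) :=
  Measurable.lintegral_prod_right (f := κ) hκ.measurable

theorem energy_symm (hκ : IsKernel κ) (μ ν : Measure X) [SFinite μ] [SFinite ν] :
    energy κ μ ν = energy κ ν μ := by
  unfold energy potential
  rw [lintegral_lintegral_swap hκ.measurable.aemeasurable]
  simp_rw [hκ.symm]

theorem energy_add_left (μ ν θ : Measure X) :
    energy κ (μ + ν) θ = energy κ μ θ + energy κ ν θ := by
  simp [energy, lintegral_add_measure]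

theorem energy_smul_left (c : NNReal) (μ θ : Measure X) :
    energy κ (c • μ) θ = c * energy κ μ θ := by
  simp only [energy, lintegral_smul_measure]
  rfl

theorem energy_add_right (hκ : IsKernel κ) (μ ν θ : Measure X)
    [SFinite μ] [SFinite ν] [SFinite θ] :
    energy κ θ (μ + ν) = energy κ θ μ + energy κ θ ν := by
  rw [energy_symm hκ, energy_add_left, energy_symm hκ μ, energy_symm hκ ν]

theorem energy_smul_right (hκ : IsKernel κ) (c : NNReal) (μ θ : Measure X)
    [SFinite μ] [SFinite θ] :
    energy κ θ (c • μ) = c * energy κ θ μ := by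
  rw [energy_symm hκ, energy_smul_left, energy_symm hκ μ]

theorem energy_ne_top (hR1 : R1 κ) {μ ν : Measure X} (hμ : memE κ μ) (hν : memE κ ν) :
    energy κ μ ν ≠ ⊤ := by
  have h := (hR1.perfect.posdef μ ν hμ.1 hν.1 hμ.2 hν.2).1
  intro h'
  rw [h'] at h
  have h2 : energy κ μ μ + energy κ ν ν < ⊤ := ENNReal.add_lt_top.2 ⟨hμ.2, hν.2⟩
  simp at h
  rcases h with h | h
  · exact hμ.2.ne h
  · exact hν.2.ne h

/-- The real-valued form of positive definiteness. -/
theorem posdef_real (hR1 : R1 κ) {μ ν : Measure X} (hμ : memE κ μ) (hν : memE κ ν) :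
    2 * (energy κ μ ν).toReal ≤ (energy κ μ μ).toReal + (energy κ ν ν).toReal := by
  have h := (hR1.perfect.posdef μ ν hμ.1 hν.1 hμ.2 hν.2).1
  have := ENNReal.toReal_mono (ENNReal.add_ne_top.2 ⟨hμ.2.ne, hν.2.ne⟩) h
  rwa [ENNReal.toReal_mul, ENNReal.toReal_add hμ.2.ne hν.2.ne] at this

theorem quad_nonneg (hκ : IsKernel κ) (hR1 : R1 κ) {μ ν θ : Measure X} (hμ : memE κ μ)
    (hν : memE κ ν) (hθ : memE κ θ) (c : NNReal) :
    0 ≤ (energy κ θ θ).toReal * ((c : ℝ) * c) +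
      (2 * ((energy κ μ θ).toReal - (energy κ ν θ).toReal)) * c +
      ((energy κ μ μ).toReal + (energy κ ν ν).toReal - 2 * (energy κ μ ν).toReal) := by
  haveI : μ.Regular := hμ.1
  haveI : ν.Regular := hν.1
  haveI : θ.Regular := hθ.1
  have e : energy κ (μ + c • θ) (μ + c • θ) =
      energy κ μ μ + c * energy κ μ θ + (c * energy κ μ θ + c * (c * energy κ θ θ)) := by
    rw [energy_add_left, energy_add_right hκ, energy_add_right hκ, energy_smul_left,
      energy_smul_right hκ, energy_smul_left, energy_smul_right hκ, energy_symm hκ θ μ]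
  have e2 : energy κ (μ + c • θ) ν = energy κ μ ν + c * energy κ ν θ := by
    rw [energy_add_left, energy_smul_left, energy_symm hκ θ ν]
  have t1 := energy_ne_top hR1 hμ hμ
  have t2 := energy_ne_top hR1 hμ hθ
  have t3 := energy_ne_top hR1 hθ hθ
  have t4 := energy_ne_top hR1 hμ hν
  have t5 := energy_ne_top hR1 hν hθ
  have m2 : (c : ℝ≥0∞) * energy κ μ θ ≠ ⊤ := ENNReal.mul_ne_top ENNReal.coe_ne_top t2
  have m3 : (c : ℝ≥0∞) * (c * energy κ θ θ) ≠ ⊤ :=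
    ENNReal.mul_ne_top ENNReal.coe_ne_top (ENNReal.mul_ne_top ENNReal.coe_ne_top t3)
  have m5 : (c : ℝ≥0∞) * energy κ ν θ ≠ ⊤ := ENNReal.mul_ne_top ENNReal.coe_ne_top t5
  have hmem : memE κ (μ + c • θ) := by
    haveI : IsFiniteMeasureOnCompacts (μ + c • θ) := ⟨fun K hK => by
      rw [Measure.add_apply]
      refine ENNReal.add_lt_top.2 ⟨hK.measure_lt_top, ?_⟩
      exact ENNReal.mul_lt_top ENNReal.coe_lt_top hK.measure_lt_top⟩
    refine ⟨isRadon_of_finiteOnCompacts _, ?_⟩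
    unfold FiniteEnergy
    rw [e, lt_top_iff_ne_top]
    exact ENNReal.add_ne_top.2 ⟨ENNReal.add_ne_top.2 ⟨t1, m2⟩, ENNReal.add_ne_top.2 ⟨m2, m3⟩⟩
  have h := posdef_real hR1 hmem hν
  rw [e, e2, ENNReal.toReal_add (ENNReal.add_ne_top.2 ⟨t1, m2⟩) (ENNReal.add_ne_top.2 ⟨m2, m3⟩),
    ENNReal.toReal_add t1 m2, ENNReal.toReal_add m2 m3, ENNReal.toReal_add t4 m5] at h
  simp only [ENNReal.toReal_mul, ENNReal.coe_toReal] at h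
  nlinarith

/-- Cauchy-Schwarz inequality. -/
theorem cauchy_schwarz (hκ : IsKernel κ) (hR1 : R1 κ) {μ ν θ : Measure X} (hμ : memE κ μ)
    (hν : memE κ ν) (hθ : memE κ θ) :
    |(energy κ μ θ).toReal - (energy κ ν θ).toReal| ≤
      sDist κ μ ν * Real.sqrt (energy κ θ θ).toReal := by
  haveI : μ.Regular := hμ.1
  haveI : ν.Regular := hν.1
  haveI : θ.Regular := hθ.1
  have key : ∀ t : ℝ, 0 ≤ (energy κ θ θ).toReal * (t * t) +
      (2 * ((energy κ μ θ).toReal - (energy κ ν θ).toReal)) * t +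
      ((energy κ μ μ).toReal + (energy κ ν ν).toReal - 2 * (energy κ μ ν).toReal) := by
    intro t
    rcases le_total 0 t with ht | ht
    · exact quad_nonneg hκ hR1 hμ hν hθ ⟨t, ht⟩
    · have h := quad_nonneg hκ hR1 hν hμ hθ ⟨-t, by linarith⟩
      rw [energy_symm hκ ν μ] at h
      change 0 ≤ _ * (-t * -t) + _ * (-t) + _ at h
      linarith
  have h := discrim_le_zero key
  unfold discrim at h
  unfold sDist
  rw [← Real.sqrt_mul (by linarith [posdef_real hR1 hμ hν])]
  apply Real.abs_le_sqrt
  linarith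

theorem tendsto_energy (hκ : IsKernel κ) (hR1 : R1 κ) {ν : ℕ → Measure X} {μ θ : Measure X}
    (hμ : memE κ μ) (hν : ∀ j, memE κ (ν j)) (hθ : memE κ θ)
    (h : Tendsto (fun j => sDist κ μ (ν j)) atTop (𝓝 0)) :
    Tendsto (fun j => energy κ (ν j) θ) atTop (𝓝 (energy κ μ θ)) := by
  rw [← ENNReal.tendsto_toReal_iff (fun j => energy_ne_top hR1 (hν j) hθ)
    (energy_ne_top hR1 hμ hθ), tendsto_iff_dist_tendsto_zero]
  have h0 := h.mul_const (Real.sqrt (energy κ θ θ).toReal)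
  rw [zero_mul] at h0
  refine squeeze_zero (fun _ => dist_nonneg) (fun j => ?_) h0
  rw [dist_comm, Real.dist_eq]
  exact cauchy_schwarz hκ hR1 hμ (hν j) hθ

theorem exists_seq {A : Set X} {μ : Measure X} (h : memEClos κ A μ) :
    ∃ ν : ℕ → Measure X, (∀ j, memEOn κ A (ν j)) ∧
      Tendsto (fun j => sDist κ μ (ν j)) atTop (𝓝 0) := by
  choose ν h1 h2 using fun j : ℕ => h.2 (1 / ((j : ℝ) + 1)) (by positivity)
  exact ⟨ν, h1, squeeze_zero (fun _ => Real.sqrt_nonneg _) (fun j => (h2 j).le)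
    tendsto_one_div_add_atTop_nhds_zero_nat⟩

theorem vague_of_seq (hκ : IsKernel κ) (hR1 : R1 κ) {ν : ℕ → Measure X} {μ : Measure X}
    (hμ : memE κ μ) (hν : ∀ j, memE κ (ν j))
    (h : Tendsto (fun j => sDist κ μ (ν j)) atTop (𝓝 0)) : VagueTendsto ν μ := by
  refine hR1.perfect.finerThanVague ν μ hν hμ (h.congr fun j => ?_)
  haveI : μ.Regular := hμ.1
  haveI : (ν j).Regular := (hν j).1
  unfold sDist
  rw [energy_symm hκ μ (ν j), add_comm (energy κ μ μ).toReal]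

/-- Lower semicontinuity of the mass of open sets under vague convergence. -/
theorem open_le_liminf {ν : ℕ → Measure X} {μ : Measure X} (hμ : IsRadon μ)
    (hν : ∀ j, IsRadon (ν j)) (h : VagueTendsto ν μ) {G : Set X} (hG : IsOpen G) :
    μ G ≤ liminf (fun j => ν j G) atTop := by
  haveI : μ.Regular := hμ
  haveI : ∀ j, (ν j).Regular := hν
  rw [hG.measure_eq_iSup_isCompact]
  refine iSup₂_le fun K hKG => iSup_le fun hK => ?_
  obtain ⟨f, hf1, hf0, hfc, hf⟩ :=
    exists_continuous_one_zero_of_isCompact hK hG.isClosed_compl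
      (disjoint_compl_right_iff_subset.2 hKG)
  have hlim := ENNReal.tendsto_ofReal (h f f.continuous hfc)
  have e : ∀ (m : Measure X) [m.Regular],
      ENNReal.ofReal (∫ x, f x ∂m) = ∫⁻ x, ENNReal.ofReal (f x) ∂m := fun m _ =>
    ofReal_integral_eq_lintegral_ofReal (f.continuous.integrable_of_hasCompactSupport hfc)
      (Eventually.of_forall fun x => (hf x).1)
  calc μ K ≤ ∫⁻ x, ENNReal.ofReal (f x) ∂μ := by
        rw [← lintegral_indicator_one hK.measurableSet]
        refine lintegral_mono fun x => ?_
        by_cases hx : x ∈ K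
        · simp [hx, hf1 hx]
        · simp [hx]
    _ = liminf (fun j => ENNReal.ofReal (∫ x, f x ∂(ν j))) atTop := by
        rw [hlim.liminf_eq, e]
    _ ≤ liminf (fun j => ν j G) atTop := by
        refine liminf_le_liminf (Eventually.of_forall fun j => ?_)
        rw [e, ← lintegral_indicator_one hG.measurableSet]
        refine lintegral_mono fun x => ?_
        by_cases hx : x ∈ G
        · simpa [hx] using (hf x).2
        · simp [hx, hf0 (show x ∈ Gᶜ from hx)]

theorem open_null {ν : ℕ → Measure X} {μ : Measure X} (hμ : IsRadon μ)
    (hν : ∀ j, IsRadon (ν j)) (h : VagueTendsto ν μ) {G : Set X} (hG : IsOpen G)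
    (h0 : ∀ j, ν j G = 0) : μ G = 0 := by
  have := open_le_liminf hμ hν h hG
  simpa [h0] using this

/-- Measures of finite energy on `A` do not charge sets of inner capacity zero. -/
theorem ae_eq_of_innerCap {A : Set X} {ν : Measure X} (hν : memEOn κ A ν) {f g : X → ℝ≥0∞}
    (hf : Measurable f) (hg : Measurable g) (h : innerCap κ {x ∈ A | f x ≠ g x} = 0) :
    ∀ᵐ x ∂ν, f x = g x := by
  haveI : ν.Regular := hν.1.1
  by_contra hcon
  have hN : MeasurableSet {x | f x ≠ g x} := (measurableSet_eq_fun hf hg).compl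
  have hpos : ν {x | f x ≠ g x} ≠ 0 := hcon
  set Z := toMeasurable ν Aᶜ with hZ
  have hZ0 : ν Z = 0 := by rw [hZ, measure_toMeasurable, hν.2]
  have hS : MeasurableSet ({x | f x ≠ g x} \ Z) := hN.diff (measurableSet_toMeasurable _ _)
  have hSpos : 0 < ν ({x | f x ≠ g x} \ Z) := by
    rw [measure_sdiff_null hZ0]
    exact pos_iff_ne_zero.2 hpos
  obtain ⟨K, hKS, hK, hKpos⟩ := hS.exists_lt_isCompact hSpos
  have hKtop : ν K ≠ ⊤ := hK.measure_lt_top.ne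
  have hKA : K ⊆ {x ∈ A | f x ≠ g x} := by
    intro x hx
    refine ⟨?_, (hKS hx).1⟩
    by_contra hxA
    exact (hKS hx).2 (subset_toMeasurable _ _ hxA)
  have hcapK : capC κ K = 0 := by
    refine le_antisymm ?_ zero_le
    rw [← h]
    exact le_iSup₂_of_le K hK (le_iSup_of_le hKA le_rfl)
  unfold capC at hcapK
  rw [ENNReal.inv_eq_zero] at hcapK
  simp only [iInf_eq_top] at hcapK
  have hc := hcapK ((ν K)⁻¹ • ν.restrict K)
    ⟨by simp [ENNReal.inv_mul_cancel hKpos.ne' hKtop]⟩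
    (by simp [Measure.restrict_apply hK.measurableSet.compl])
  have hI : energy κ (ν.restrict K) (ν.restrict K) ≤ energy κ ν ν := by
    unfold energy potential
    refine lintegral_mono' Measure.restrict_le_self fun x => ?_
    exact lintegral_mono' Measure.restrict_le_self le_rfl
  have hinv : (ν K)⁻¹ ≠ ⊤ := ENNReal.inv_ne_top.2 hKpos.ne'
  have e : energy κ ((ν K)⁻¹ • ν.restrict K) ((ν K)⁻¹ • ν.restrict K) =
      (ν K)⁻¹ * ((ν K)⁻¹ * energy κ (ν.restrict K) (ν.restrict K)) := by
    unfold energy potential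
    simp only [lintegral_smul_measure, smul_eq_mul]
    rw [lintegral_const_mul' _ _ hinv]
  rw [e] at hc
  exact ENNReal.mul_ne_top hinv (ENNReal.mul_ne_top hinv (hI.trans_lt hν.1.2).ne) hc

theorem potential_dirac (x y : X) : potential κ (Measure.dirac x) y = κ y x := by
  simp [potential]

/-- Potentials are lower semicontinuous. -/
theorem lsc_potential (hκ : IsKernel κ) (μ : Measure X) : LowerSemicontinuous (potential κ μ) := by
  intro x t ht
  by_contra hcon
  rw [Filter.not_eventually] at hcon
  obtain ⟨u, hu, hfr⟩ := exists_seq_forall_of_frequently hcon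
  have hk : ∀ y, κ x y ≤ liminf (fun n => κ (u n) y) atTop := by
    intro y
    have h1 : LowerSemicontinuousAt (fun z => κ z y) x :=
      (hκ.lsc.comp (g := fun z : X => (z, y)) (by fun_prop)) x
    refine le_of_forall_lt fun c hc => ?_
    obtain ⟨d, hcd, hd⟩ := exists_between hc
    refine hcd.trans_le (le_liminf_of_le (by isBoundedDefault) ?_)
    exact (hu.eventually (h1 d hd)).mono fun n hn => hn.le
  have hm : ∀ n, Measurable fun y => κ (u n) y := fun n =>
    hκ.measurable.comp (measurable_const.prodMk measurable_id)
  have h2 : potential κ μ x ≤ t := calc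
    potential κ μ x ≤ ∫⁻ y, liminf (fun n => κ (u n) y) atTop ∂μ := lintegral_mono hk
    _ ≤ liminf (fun n => ∫⁻ y, κ (u n) y ∂μ) atTop := lintegral_liminf_le hm
    _ ≤ liminf (fun _ : ℕ => t) atTop :=
        liminf_le_liminf (Eventually.of_forall fun n => not_lt.1 (hfr n))
    _ = t := by simp
  exact absurd ht (not_lt.2 h2)

/-- Integrals against `ν j → b` (concentrated on `A`) of the kernel with pole off `closure A`. -/
theorem potential_le_liminf (hκ : IsKernel κ) (hR2 : R2 κ) {ν : ℕ → Measure X} {μ : Measure X}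
    (hμ : IsRadon μ) (hν : ∀ j, IsRadon (ν j)) (h : VagueTendsto ν μ) {x : X}
    (hx : μ {x} = 0) :
    potential κ μ x ≤ liminf (fun j => potential κ (ν j) x) atTop := by
  haveI : μ.Regular := hμ
  haveI : ∀ j, (ν j).Regular := hν
  have hkm : Measurable fun y => κ x y :=
    hκ.measurable.comp (measurable_const.prodMk measurable_id)
  set g : X → ℝ := indicator ({x}ᶜ) fun y => (κ x y).toReal with hg
  have hgm : Measurable g := hkm.ennreal_toReal.indicator (measurableSet_singleton x).compl
  have hg0 : ∀ y, 0 ≤ g y := fun y => indicator_nonneg (fun _ _ => ENNReal.toReal_nonneg) y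
  have hle : ∀ y, ENNReal.ofReal (g y) ≤ κ x y := by
    intro y
    by_cases hy : y = x
    · simp [hg, hy]
    · simp [hg, hy, ENNReal.ofReal_toReal_le]
  have hopen : ∀ t : ℝ, 0 < t → IsOpen {y | t < g y} := by
    intro t ht
    have hc : ContinuousOn (fun y => (κ x y).toReal) ({x}ᶜ : Set X) := by
      have h1 : ContinuousOn (fun y => κ x y) ({x}ᶜ : Set X) :=
        hR2.1.comp (f := fun y : X => (x, y)) (by fun_prop) fun y hy => fun e => hy (by simpa using e.symm)
      exact ENNReal.continuousOn_toReal.comp h1 fun y hy => hR2.2 x y fun e => hy (by simpa using e.symm)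
    have : {y | t < g y} = {x}ᶜ ∩ (fun y => (κ x y).toReal) ⁻¹' Ioi t := by
      ext y
      by_cases hy : y = x
      · simp [hg, hy, ht.le]
      · simp [hg, hy]
    rw [this]
    exact hc.isOpen_inter_preimage isOpen_compl_singleton isOpen_Ioi
  have lay : ∀ m : Measure X, ∫⁻ y, ENNReal.ofReal (g y) ∂m = ∫⁻ t in Ioi (0 : ℝ), m {y | t < g y} :=
    fun m => lintegral_eq_lintegral_meas_lt m (Eventually.of_forall hg0) hgm.aemeasurable
  calc potential κ μ x = ∫⁻ y, ENNReal.ofReal (g y) ∂μ := by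
        refine lintegral_congr_ae ?_
        filter_upwards [measure_eq_zero_iff_ae_notMem.1 hx] with y hy
        have hy' : y ≠ x := by simpa using hy
        simp [hg, hy', ENNReal.ofReal_toReal (hR2.2 x y hy'.symm)]
    _ = ∫⁻ t in Ioi (0 : ℝ), μ {y | t < g y} := lay μ
    _ ≤ ∫⁻ t in Ioi (0 : ℝ), liminf (fun j => ν j {y | t < g y}) atTop := by
        refine setLIntegral_mono' measurableSet_Ioi fun t ht => ?_
        exact open_le_liminf hμ hν h (hopen t ht)
    _ ≤ liminf (fun j => ∫⁻ t in Ioi (0 : ℝ), ν j {y | t < g y}) atTop := by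
        refine lintegral_liminf_le fun j => Antitone.measurable fun s t hst => ?_
        exact measure_mono fun y hy => lt_of_le_of_lt hst hy
    _ ≤ liminf (fun j => potential κ (ν j) x) atTop := by
        refine liminf_le_liminf (Eventually.of_forall fun j => ?_)
        rw [← lay]
        exact lintegral_mono hle

/-- `I(ε, θ) = I(ε, b)` for `ε ∈ E'(A)` and `b` the balayage of `θ`. -/
theorem energy_balayage (hκ : IsKernel κ) (hR1 : R1 κ) {A : Set X} {θ b μ : Measure X}
    (hθ : memE κ θ) (hb : IsInnerBalayage κ A θ b) (hμ : memEClos κ A μ) :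
    energy κ μ θ = energy κ μ b := by
  haveI : θ.Regular := hθ.1
  haveI : b.Regular := hb.1.1.1
  obtain ⟨ν, hν, hlim⟩ := exists_seq hμ
  have h1 := tendsto_energy hκ hR1 hμ.1 (fun j => (hν j).1) hθ hlim
  have h2 := tendsto_energy hκ hR1 hμ.1 (fun j => (hν j).1) hb.1.1 hlim
  refine tendsto_nhds_unique (h1.congr fun j => ?_) h2
  refine lintegral_congr_ae ?_
  filter_upwards [ae_eq_of_innerCap (hν j) (measurable_potential hκ b)
    (measurable_potential hκ θ) hb.2] with y hy using hy.symm

theorem closure_compl_null (hκ : IsKernel κ) (hR1 : R1 κ) {A : Set X} {μ : Measure X}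
    (hμ : memEClos κ A μ) : μ (closure A)ᶜ = 0 := by
  obtain ⟨ν, hν, hlim⟩ := exists_seq hμ
  refine open_null hμ.1.1 (fun j => (hν j).1.1)
    (vague_of_seq hκ hR1 hμ.1 (fun j => (hν j).1) hlim) isClosed_closure.isOpen_compl fun j => ?_
  exact measure_mono_null (compl_subset_compl.2 subset_closure) (hν j).2

theorem singleton_null (hκ : IsKernel κ) (hR1 : R1 κ) {A : Set X} {μ : Measure X}
    (hμ : memEClos κ A μ) {x : X} (hx : x ∈ (closure A)ᶜ) : μ {x} = 0 :=
  measure_mono_null (singleton_subset_iff.2 hx) (closure_compl_null hκ hR1 hμ)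

/-- The swept Dirac potential is dominated by the kernel. -/
theorem potential_le_kernel (hκ : IsKernel κ) (hR1 : R1 κ) (hR2 : R2 κ) {A : Set X} {x : X}
    (hx : x ∈ (closure A)ᶜ) {ε : Measure X} (hε : IsInnerBalayage κ A (Measure.dirac x) ε) (y : X) :
    potential κ ε y ≤ κ y x := by
  haveI : ε.Regular := hε.1.1.1
  rw [← potential_dirac (κ := κ) x y]
  refine hR1.domination ε (Measure.dirac x) hε.1.1 (isRadon_of_finiteOnCompacts _) ?_ y
  obtain ⟨ν, hν, hlim⟩ := exists_seq hε.1
  have hG : IsOpen ({x}ᶜ ∩ {z | κ z x < potential κ ε z}) := by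
    rw [isOpen_iff_mem_nhds]
    rintro z ⟨hz, hlt⟩
    have hz' : z ≠ x := by simpa using hz
    obtain ⟨c, hc1, hc2⟩ := exists_between (show κ z x < potential κ ε z from hlt)
    have hcont : ContinuousOn (fun z => κ z x) ({x}ᶜ : Set X) :=
      hR2.1.comp (f := fun z : X => (z, x)) (by fun_prop) fun y hy => by simpa using hy
    have h1 : ∀ᶠ w in 𝓝 z, κ w x < c :=
      (hcont.continuousAt (isOpen_compl_singleton.mem_nhds hz)).eventually_lt_const hc1
    filter_upwards [isOpen_compl_singleton.mem_nhds hz, h1, lsc_potential hκ ε z c hc2]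
      with w hw1 hw2 hw3
    exact ⟨hw1, hw2.trans hw3⟩
  have h0 := open_null hε.1.1.1 (fun j => (hν j).1.1)
    (vague_of_seq hκ hR1 hε.1.1 (fun j => (hν j).1) hlim) hG fun j => by
      have hae := ae_eq_of_innerCap (hν j) (measurable_potential hκ ε)
        (measurable_potential hκ (Measure.dirac x)) hε.2
      rw [measure_eq_zero_iff_ae_notMem]
      filter_upwards [hae] with z hz hmem
      rw [potential_dirac] at hz
      exact absurd hz hmem.2.ne'
  filter_upwards [measure_eq_zero_iff_ae_notMem.1 h0,
    measure_eq_zero_iff_ae_notMem.1 (singleton_null hκ hR1 hε.1 hx)] with z hz1 hz2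
  rw [potential_dirac]
  by_contra hlt
  exact hz1 ⟨hz2, not_le.1 hlt⟩

/-- The key identity `U^b(x) = I(b, ε_x^A)`. -/
theorem potential_eq_energy (hκ : IsKernel κ) (hR1 : R1 κ) (hR2 : R2 κ) {A : Set X} {x : X}
    (hx : x ∈ (closure A)ᶜ) {ε : Measure X} (hε : IsInnerBalayage κ A (Measure.dirac x) ε)
    {b : Measure X} (hb : memEClos κ A b) : potential κ b x = energy κ b ε := by
  haveI : ε.Regular := hε.1.1.1
  apply le_antisymm
  · obtain ⟨ν, hν, hlim⟩ := exists_seq hb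
    have h1 := potential_le_liminf hκ hR2 hb.1.1 (fun j => (hν j).1.1)
      (vague_of_seq hκ hR1 hb.1 (fun j => (hν j).1) hlim) (singleton_null hκ hR1 hb hx)
    refine h1.trans (le_of_eq ?_)
    rw [← (tendsto_energy hκ hR1 hb.1 (fun j => (hν j).1) hε.1.1 hlim).liminf_eq]
    congr 1
    ext j
    refine lintegral_congr_ae ?_
    filter_upwards [ae_eq_of_innerCap (hν j) (measurable_potential hκ ε)
      (measurable_potential hκ (Measure.dirac x)) hε.2] with y hy
    rw [hy, potential_dirac, hκ.symm]
  · refine lintegral_mono fun y => ?_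
    rw [hκ.symm x y]
    exact potential_le_kernel hκ hR1 hR2 hx hε y

theorem lsc_toReal {f : X → ℝ≥0∞} (hf : LowerSemicontinuous f) {s : Set X}
    (hs : ∀ x ∈ s, f x ≠ ⊤) : LowerSemicontinuousOn (fun x => (f x).toReal) s := by
  intro x hx t ht
  rcases lt_or_ge t 0 with h0 | h0
  · exact Eventually.of_forall fun y => h0.trans_le ENNReal.toReal_nonneg
  · have h1 : ENNReal.ofReal t < f x := (ENNReal.ofReal_lt_iff_lt_toReal h0 (hs x hx)).2 ht
    filter_upwards [mem_nhdsWithin_of_mem_nhds (hf x _ h1), self_mem_nhdsWithin] with y hy hys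
    exact (ENNReal.ofReal_lt_iff_lt_toReal h0 (hs y hys)).1 hy

end Helpers

/-- For `ψ = U^θ ∈ C_0(X)` with `θ = θp - θn ∈ E`, one has
`ε_x^A(ψ) = U^{(θp)^A}(x) - U^{(θn)^A}(x)` for all `x ∈ Ω`; in particular `x ↦ ε_x^A(ψ)`
is a difference of two lower semicontinuous functions on `Ω`. -/
theorem dirac_balayage_of_potential
    {X : Type*} [TopologicalSpace X] [T2Space X] [LocallyCompactSpace X]
    [SecondCountableTopology X] [MeasurableSpace X] [BorelSpace X]
    (κ : X → X → ℝ≥0∞) (hκ : IsKernel κ) (hR1 : R1 κ) (hR2 : R2 κ) (hR3 : R3 κ)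
    (A : Set X) (hA : closure A ≠ Set.univ) (hcap : 0 < innerCap κ A)
    (θp θn : Measure X) (hθp : memE κ θp) (hθn : memE κ θn)
    (ψ : X → ℝ) (hψc : Continuous ψ) (hψs : HasCompactSupport ψ)
    (hψ : ∀ x : X, potential κ θp x ≠ ⊤ ∧ potential κ θn x ≠ ⊤ ∧
      ψ x = (potential κ θp x).toReal - (potential κ θn x).toReal)
    (εA : X → Measure X)
    (hεA : ∀ x ∈ (closure A)ᶜ, IsInnerBalayage κ A (Measure.dirac x) (εA x))
    (bp bn : Measure X)
    (hbp : IsInnerBalayage κ A θp bp) (hbn : IsInnerBalayage κ A θn bn) :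
    (∀ x ∈ (closure A)ᶜ,
      ∫ z, ψ z ∂(εA x) = (potential κ bp x).toReal - (potential κ bn x).toReal) ∧
    ∃ u v : X → ℝ, LowerSemicontinuousOn u (closure A)ᶜ ∧
      LowerSemicontinuousOn v (closure A)ᶜ ∧
      ∀ x ∈ (closure A)ᶜ, ∫ z, ψ z ∂(εA x) = u x - v x := by
  have key : ∀ x ∈ (closure A)ᶜ, ∀ θ b : Measure X, memE κ θ → IsInnerBalayage κ A θ b →
      potential κ b x = energy κ (εA x) θ := by
    intro x hx θ b hθ hb
    haveI : (εA x).Regular := (hεA x hx).1.1.1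
    haveI : b.Regular := hb.1.1.1
    rw [potential_eq_energy hκ hR1 hR2 hx (hεA x hx) hb.1, energy_symm hκ,
      energy_balayage hκ hR1 hθ hb (hεA x hx).1]
  have fin : ∀ x ∈ (closure A)ᶜ, ∀ θ b : Measure X, memE κ θ → IsInnerBalayage κ A θ b →
      potential κ b x ≠ ⊤ := by
    intro x hx θ b hθ hb
    rw [key x hx θ b hθ hb]
    exact energy_ne_top hR1 (hεA x hx).1.1 hθ
  have main : ∀ x ∈ (closure A)ᶜ,
      ∫ z, ψ z ∂(εA x) = (potential κ bp x).toReal - (potential κ bn x).toReal := by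
    intro x hx
    haveI : θp.Regular := hθp.1
    haveI : θn.Regular := hθn.1
    have hmp := measurable_potential hκ θp
    have hmn := measurable_potential hκ θn
    have tp : ∫⁻ z, potential κ θp z ∂(εA x) ≠ ⊤ := energy_ne_top hR1 (hεA x hx).1.1 hθp
    have tn : ∫⁻ z, potential κ θn z ∂(εA x) ≠ ⊤ := energy_ne_top hR1 (hεA x hx).1.1 hθn
    rw [key x hx θp bp hθp hbp, key x hx θn bn hθn hbn]
    simp_rw [fun z => (hψ z).2.2]
    rw [integral_sub (integrable_toReal_of_lintegral_ne_top hmp.aemeasurable tp)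
      (integrable_toReal_of_lintegral_ne_top hmn.aemeasurable tn),
      integral_toReal hmp.aemeasurable (Eventually.of_forall fun z => (hψ z).1.lt_top),
      integral_toReal hmn.aemeasurable (Eventually.of_forall fun z => (hψ z).2.1.lt_top)]
    rfl
  exact ⟨main, fun x => (potential κ bp x).toReal, fun x => (potential κ bn x).toReal,
    lsc_toReal (lsc_potential hκ bp) (fun x hx => fin x hx θp bp hθp hbp),
    lsc_toReal (lsc_potential hκ bn) (fun x hx => fin x hx θn bn hθn hbn), main⟩

end Balayage
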